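/- Let p ≡ 1 (mod 4) be prime and q a prime not dividing 2p, inert in ℚ(√p)/ℚ. Then the multiplicative orders of ε_p mod qO_K and -ε_p mod qO_K in (O_K/qO_K)* are equal. -/

import Mathlib

open NumberField

/-- For a prime `p ≡ 1 (mod 4)` the negative Pell equation is solvable. -/
theorem exists_sq_sub_prime_mul_sq_eq_neg_one (p : ℕ) (hp : p.Prime) (hp4 : p % 4 = 1) :
    ∃ a b : ℤ, a ^ 2 - p * b ^ 2 = -1 := by
  have hpZ : Prime (p : ℤ) := Nat.prime_iff_prime_int.mp hp
  have hp0 : (0 : ℤ) < p := by exact_mod_cast hp.pos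
  obtain ⟨f, hx, hy, hmin⟩ := Pell.IsFundamental.exists_of_not_isSquare hp0 hpZ.not_isSquare
  have hxy := f.prop
  obtain ⟨k, hk⟩ : ∃ k : ℤ, (p : ℤ) = 4 * k + 1 := ⟨p / 4, by omega⟩
  obtain ⟨s, hs, t, ht⟩ : ∃ s : ℤ, f.x = 2 * s + 1 ∧ ∃ t : ℤ, f.y = 2 * t := by
    rcases Int.even_or_odd' f.x with ⟨s, hs | hs⟩ <;>
      rcases Int.even_or_odd' f.y with ⟨t, ht | ht⟩
    · exfalso
      rw [hs, ht] at hxy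
      have : 2 * (2 * (s ^ 2 - p * t ^ 2)) = 1 := by linarith
      omega
    · exfalso
      rw [hs, ht, hk] at hxy
      have : 4 * (s ^ 2 - (4 * k + 1) * (t ^ 2 + t) - k) = 2 := by linarith
      omega
    · exact ⟨s, hs, t, ht⟩
    · exfalso
      rw [hs, ht, hk] at hxy
      have : 4 * (s ^ 2 + s - (4 * k + 1) * (t ^ 2 + t) - k) = 1 := by linarith
      omega
  have hst : s * (s + 1) = p * t ^ 2 := by
    rw [hs, ht] at hxy
    linarith
  have hs0 : 0 < s := by omega
  rcases hpZ.dvd_or_dvd (Dvd.intro _ hst.symm) with ⟨r, hr⟩ | ⟨r, hr⟩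
  · exfalso
    have hr0 : 0 < r := by
      by_contra! h
      nlinarith
    have hrs : r * (s + 1) = t ^ 2 := by
      apply mul_left_cancel₀ hpZ.ne_zero
      rw [← hst, ← mul_assoc, ← hr]
    have hco : IsCoprime r (s + 1) := ⟨-p, 1, by rw [hr]; ring⟩
    obtain ⟨b, hb | hb⟩ := Int.sq_of_isCoprime hco hrs
    · obtain ⟨a, ha | ha⟩ := Int.sq_of_isCoprime hco.symm ((mul_comm _ _).trans hrs)
      · have ha1 : 1 < |a| := by
          by_contra! h
          have := sq_abs a
          nlinarith [abs_nonneg a]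
        have hsol : |a| ^ 2 - p * b ^ 2 = 1 := by
          rw [sq_abs, ← ha, ← hb, ← hr]
          ring
        have hle : f.x ≤ |a| := hmin (b := Pell.Solution₁.mk |a| b hsol) (by simpa using ha1)
        nlinarith [sq_abs a]
      · nlinarith [sq_nonneg a]
    · nlinarith [sq_nonneg b]
  · have hr0 : 0 < r := by
      by_contra! h
      nlinarith
    have hrs : s * r = t ^ 2 := by
      apply mul_left_cancel₀ hpZ.ne_zero
      rw [← hst, hr]
      ring
    have hco : IsCoprime s r := ⟨-1, p, by rw [← hr]; ring⟩
    obtain ⟨a, ha | ha⟩ := Int.sq_of_isCoprime hco hrs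
    · obtain ⟨b, hb | hb⟩ := Int.sq_of_isCoprime hco.symm ((mul_comm _ _).trans hrs)
      · exact ⟨a, b, by rw [← ha, ← hb, ← hr]; ring⟩
      · nlinarith [sq_nonneg b]
    · nlinarith [sq_nonneg a]

/-- If `-1` is an even power of `u`, then `u` and `-u` have the same order. -/
theorem orderOf_neg_eq_of_zpow_eq_neg_one {G : Type*} [Group G] [HasDistribNeg G] {u : G} {m : ℤ}
    (hm : Even m) (hu : u ^ m = -1) : orderOf (-u) = orderOf u := by
  apply Nat.dvd_antisymm
  · exact orderOf_dvd_of_mem_zpowers ⟨m + 1, by simp [zpow_add, hu]⟩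
  · exact orderOf_dvd_of_mem_zpowers ⟨m + 1, by simp [zpow_add, hm.neg_zpow, hu]⟩

/-- A square root of a rational prime has trace zero. -/
theorem trace_eq_zero_of_sq_eq_prime {K : Type*} [Field K] [NumberField K] {p : ℕ} (hp : p.Prime)
    {α : K} (hα : α ^ 2 = (p : K)) : Algebra.trace ℚ K α = 0 := by
  open Polynomial in
  have hirr : Irreducible (X ^ 2 - C (p : ℚ)) := by
    apply X_pow_sub_C_irreducible_of_prime Nat.prime_two
    intro b hb
    have hsq : IsSquare ((p : ℕ) : ℚ) := ⟨b, by rw [← hb, sq]⟩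
    exact hp.prime.not_isSquare (Rat.isSquare_natCast_iff.mp hsq)
  have hmin := minpoly.eq_of_irreducible_of_monic (x := α) hirr (by simp [hα])
    (Polynomial.monic_X_pow_sub_C _ two_ne_zero)
  have hnat : (Polynomial.X ^ 2 - Polynomial.C (p : ℚ)).natDegree = 2 :=
    Polynomial.natDegree_X_pow_sub_C
  rw [trace_eq_finrank_mul_minpoly_nextCoeff, ← hmin,
    Polynomial.nextCoeff_of_natDegree_pos (by rw [hnat]; exact two_pos), hnat,
    Polynomial.coeff_sub, Polynomial.coeff_X_pow, Polynomial.coeff_C]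
  simp

/-- A rational prime that divides a rational integer in `𝓞 K` divides it in `ℤ`. -/
theorem intCast_dvd_of_dvd_ringOfIntegers {K : Type*} [Field K] {q : ℕ}
    (hq : q.Prime) (hunit : ¬ IsUnit (q : 𝓞 K)) {n : ℤ} (h : (q : 𝓞 K) ∣ (n : 𝓞 K)) :
    (q : ℤ) ∣ n := by
  by_contra hn
  obtain ⟨x, y, hxy⟩ := (Nat.prime_iff_prime_int.mp hq).coprime_iff_not_dvd.mpr hn
  apply hunit
  apply isUnit_of_dvd_one
  have : (x : 𝓞 K) * q + y * n = 1 := by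
    simpa using congrArg (Int.cast (R := 𝓞 K)) hxy
  rw [← this]
  exact dvd_add (Dvd.intro_left _ rfl) (h.mul_left _)

/-- `√p` is not congruent to a rational integer modulo an odd prime `q ≠ p`. -/
theorem not_dvd_sub_intCast {K : Type*} [Field K] [NumberField K] {p q : ℕ} (hp : p.Prime)
    (hq : q.Prime) (hq2p : ¬ q ∣ 2 * p) (hdeg : Module.finrank ℚ K = 2) {β : 𝓞 K}
    (hβ : β ^ 2 = (p : 𝓞 K)) (hunit : ¬ IsUnit (q : 𝓞 K)) (c : ℤ) :
    ¬ (q : 𝓞 K) ∣ β - c := by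
  rintro ⟨γ, hγ⟩
  have hqZ : Prime (q : ℤ) := Nat.prime_iff_prime_int.mp hq
  have hβK : (β : K) ^ 2 = (p : K) := by
    have := congrArg (fun x : 𝓞 K => (x : K)) hβ
    simpa using this
  have htr : (q : ℤ) * Algebra.trace ℤ (𝓞 K) γ = -(2 * c) := by
    have hγK : (γ : K) * q = β - algebraMap ℚ K c := by
      have := congrArg (fun x : 𝓞 K => (x : K)) hγ
      simp at this
      simp [this, mul_comm]
    have h := congrArg (Algebra.trace ℚ K) hγK
    rw [map_sub, trace_eq_zero_of_sq_eq_prime hp hβK, Algebra.trace_algebraMap, hdeg,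
      mul_comm, ← nsmul_eq_mul, map_nsmul, ← Algebra.coe_trace_int] at h
    rw [← Int.cast_inj (α := ℚ)]
    simpa using h
  have hc : (q : ℤ) ∣ c := by
    refine (hqZ.dvd_or_dvd (dvd_neg.mp (Dvd.intro _ htr))).resolve_left fun h2 => hq2p ?_
    exact Dvd.dvd.mul_right (by exact_mod_cast h2) p
  have hqβ : (q : 𝓞 K) ∣ β := by
    have hc' : (q : 𝓞 K) ∣ (c : 𝓞 K) := by
      have := map_dvd (Int.castRingHom (𝓞 K)) hc
      simpa using this
    rw [← sub_add_cancel β (c : 𝓞 K), hγ]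
    exact dvd_add (Dvd.intro _ rfl) hc'
  have hqp : (q : 𝓞 K) ∣ ((p : ℤ) : 𝓞 K) := by
    rw [Int.cast_natCast, ← hβ, sq]
    exact hqβ.mul_right _
  exact hq2p (Dvd.dvd.mul_left
    (Int.natCast_dvd_natCast.mp (intCast_dvd_of_dvd_ringOfIntegers hq hunit hqp)) 2)

/-- In a domain of characteristic `q`, an element fixed by Frobenius is an integer. -/
theorem exists_intCast_eq_of_pow_char_eq {F : Type*} [CommRing F] [IsDomain F] {q : ℕ}
    [Fact q.Prime] [CharP F q] {x : F} (hx : x ^ q = x) : ∃ c : ℤ, (c : F) = x := by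
  have : CharP (FractionRing F) q :=
    charP_of_injective_algebraMap (IsFractionRing.injective F (FractionRing F)) q
  have hmem : algebraMap F (FractionRing F) x ∈ (⊥ : Subfield (FractionRing F)) := by
    rw [Subfield.mem_bot_iff_pow_eq_self _ q, ← map_pow, hx]
  obtain ⟨c, hc⟩ := (mem_bot_iff_intCast q _).mp hmem
  refine ⟨c, IsFractionRing.injective F (FractionRing F) ?_⟩
  rw [map_intCast, hc]

/-- If `p ≡ 1 (mod 4)` is prime and `q ∤ 2p` is inert in `ℚ(√p)/ℚ`, then
`ε_p mod qO_K` and `-ε_p mod qO_K` have the same multiplicative order. -/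
theorem stmt_5 (p q : ℕ) (hp : p.Prime) (hp4 : p % 4 = 1)
    (hq : q.Prime) (hq2p : ¬ q ∣ 2 * p)
    (K : Type) [Field K] [NumberField K] (α : K) (hα : α ^ 2 = (p : K))
    (hdeg : Module.finrank ℚ K = 2)
    (ε : (𝓞 K)ˣ)
    (hfund : ∀ u : (𝓞 K)ˣ, ∃ n : ℤ, u = ε ^ n ∨ u = -ε ^ n)
    (hinert : Prime (q : 𝓞 K)) :
    orderOf (Ideal.Quotient.mk (Ideal.span {(q : 𝓞 K)}) (ε : 𝓞 K)) =
      orderOf (Ideal.Quotient.mk (Ideal.span {(q : 𝓞 K)}) (-(ε : 𝓞 K))) := by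
  have : Fact q.Prime := ⟨hq⟩
  set I := Ideal.span {(q : 𝓞 K)} with hI
  have : I.IsPrime := (Ideal.span_singleton_prime hinert.ne_zero).mpr hinert
  have : CharP (𝓞 K ⧸ I) q := by
    rw [CharP.charP_iff_prime_eq_zero hq, ← map_natCast (Ideal.Quotient.mk I),
      Ideal.Quotient.eq_zero_iff_mem]
    exact Ideal.mem_span_singleton_self _
  have hq_odd : Odd q := hq.odd_of_ne_two fun h => hq2p (h ▸ Dvd.intro p rfl)
  obtain ⟨β, hβα⟩ : ∃ β : 𝓞 K, (β : K) = α :=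
    ⟨⟨α, .of_pow two_pos (hα ▸ isIntegral_natCast p)⟩, rfl⟩
  have hβ : β ^ 2 = (p : 𝓞 K) := by
    apply RingOfIntegers.ext
    simpa [hβα] using hα
  set π := Ideal.Quotient.mk I
  have hfrob : π β ^ q = -π β := by
    have hsq : (π β ^ q) ^ 2 = π β ^ 2 := by
      rw [← pow_mul, mul_comm, pow_mul, ← map_pow, hβ, map_natCast, ← frobenius_def, map_natCast]
    refine (sq_eq_sq_iff_eq_or_eq_neg.mp hsq).resolve_left fun h => ?_
    obtain ⟨c, hc⟩ := exists_intCast_eq_of_pow_char_eq h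
    refine not_dvd_sub_intCast hp hq hq2p hdeg hβ hinert.not_isUnit c ?_
    rw [← Ideal.mem_span_singleton, ← Ideal.Quotient.eq_zero_iff_mem, map_sub, map_intCast]
    exact sub_eq_zero.mpr hc.symm
  obtain ⟨a, b, hab⟩ := exists_sq_sub_prime_mul_sq_eq_neg_one p hp hp4
  have hmul : ((a : 𝓞 K) + b * β) * (-a + b * β) = 1 := by
    have : (a : 𝓞 K) ^ 2 - p * b ^ 2 = -1 := by exact_mod_cast congrArg (Int.cast (R := 𝓞 K)) hab
    linear_combination (b : 𝓞 K) ^ 2 * hβ - this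
  let η : (𝓞 K)ˣ := Units.mkOfMulEqOne _ _ hmul
  have hη : Units.map (π : 𝓞 K →* 𝓞 K ⧸ I) η ^ (q + 1) = -1 := by
    ext
    have hab' : (a : 𝓞 K ⧸ I) ^ 2 - p * b ^ 2 = -1 := by
      exact_mod_cast congrArg (Int.cast (R := 𝓞 K ⧸ I)) hab
    have hβ' : π β ^ 2 = p := by rw [← map_pow, hβ, map_natCast]
    have hfr : (a + b * π β) ^ q = a - b * π β := by
      rw [← frobenius_def, map_add, map_mul, map_intCast, map_intCast, frobenius_def, hfrob]
      ring
    have hηv : π η = a + b * π β := by simp [η]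
    simp only [Units.val_pow_eq_pow_val, Units.coe_map, Units.val_neg, Units.val_one,
      MonoidHom.coe_coe, hηv]
    rw [pow_succ, hfr]
    linear_combination hab' - (b : 𝓞 K ⧸ I) ^ 2 * hβ'
  obtain ⟨n, hn⟩ := hfund η
  set u := Units.map (π : 𝓞 K →* 𝓞 K ⧸ I) ε with hu
  have heven : Even (q + 1) := hq_odd.add_one
  have hpow : u ^ (n * (q + 1 : ℕ)) = -1 := by
    rw [zpow_mul, zpow_natCast, ← hη]
    rcases hn with hn | hn
    · rw [hn, map_zpow]
    · have : Units.map (π : 𝓞 K →* 𝓞 K ⧸ I) (-ε ^ n) = -u ^ n := by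
        rw [hu, ← map_zpow]
        ext
        simp
      rw [hn, this, heven.neg_pow]
  have hord := orderOf_neg_eq_of_zpow_eq_neg_one
    (((Int.even_coe_nat _).mpr heven).mul_left n) hpow
  rw [← orderOf_units, ← orderOf_units] at hord
  simpa [hu] using hord.symm
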